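/- Let x* ∈ R^{m×m} be an orthogonal matrix and let T be the tangent cone at x* with respect to the spectral-norm unit ball (whose extreme points are the orthogonal matrices). Then the symmetric-matrix component of the tangent cone at the identity equals the negative of the positive semidefinite cone: cone{M − I : M symmetric, ||M||_op ≤ 1} = −PSD_m, and consequently w(T ∩ S^{m²−1})² ≤ (3m² − m)/4. -/

import Mathlib

open MeasureTheory ProbabilityTheory Real Matrix

/-- The standard Gaussian measure on `m × m` real matrices (i.i.d. `N(0,1)` entries),
realized on the function type `Fin m → Fin m → ℝ`. -/
noncomputable def matStdGaussian (m : ℕ) : Measure (Fin m → Fin m → ℝ) :=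
  Measure.pi fun _ : Fin m => Measure.pi fun _ : Fin m => gaussianReal 0 1

/-- Gaussian width of a set of `m × m` matrices with respect to the trace
(Frobenius) inner product `⟨G, Z⟩ = ∑ᵢⱼ Gᵢⱼ Zᵢⱼ`. -/
noncomputable def matGaussianWidth {m : ℕ} (S : Set (Matrix (Fin m) (Fin m) ℝ)) : ℝ :=
  ∫ G, sSup ((fun Z : Matrix (Fin m) (Fin m) ℝ => ∑ i, ∑ j, G i j * Z i j) '' S)
    ∂(matStdGaussian m)

/-- The spectral norm (largest singular value) of a real matrix, i.e. the operator
norm of the induced map on Euclidean space. -/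
noncomputable def specNorm {m : ℕ} (M : Matrix (Fin m) (Fin m) ℝ) : ℝ :=
  ‖(Matrix.toEuclideanCLM (𝕜 := ℝ) M : EuclideanSpace ℝ (Fin m) →L[ℝ] EuclideanSpace ℝ (Fin m))‖

/-- The unit sphere in Frobenius norm. -/
def frobSphere (m : ℕ) : Set (Matrix (Fin m) (Fin m) ℝ) :=
  {Z | ∑ i, ∑ j, (Z i j) ^ 2 = 1}

section SpectralNorm

variable {m : ℕ}

lemma dotProduct_mulVec_le_specNorm_sq (z : Matrix (Fin m) (Fin m) ℝ) (v : Fin m → ℝ) :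
    (z *ᵥ v) ⬝ᵥ (z *ᵥ v) ≤ specNorm z ^ 2 * (v ⬝ᵥ v) := by
  have norm_sq (w : Fin m → ℝ) : w ⬝ᵥ w = ‖WithLp.toLp 2 w‖ ^ 2 := by
    rw [← real_inner_self_eq_norm_sq, EuclideanSpace.inner_eq_star_dotProduct]
    simp
  rw [norm_sq, norm_sq, ← Matrix.toEuclideanCLM_toLp (𝕜 := ℝ), ← mul_pow]
  gcongr
  exact ContinuousLinearMap.le_opNorm _ _

lemma specNorm_le_one_iff {z : Matrix (Fin m) (Fin m) ℝ} :
    specNorm z ≤ 1 ↔ ∀ v, (z *ᵥ v) ⬝ᵥ (z *ᵥ v) ≤ v ⬝ᵥ v := by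
  constructor
  · intro h v
    have h0 : 0 ≤ specNorm z := norm_nonneg _
    have hv : 0 ≤ v ⬝ᵥ v := by simpa using dotProduct_star_self_nonneg v
    have := dotProduct_mulVec_le_specNorm_sq z v
    nlinarith [pow_le_one₀ (n := 2) h0 h]
  · intro h
    refine ContinuousLinearMap.opNorm_le_bound _ zero_le_one fun w => ?_
    have norm_sq (u : EuclideanSpace ℝ (Fin m)) : ‖u‖ ^ 2 = u.ofLp ⬝ᵥ u.ofLp := by
      rw [← real_inner_self_eq_norm_sq, EuclideanSpace.inner_eq_star_dotProduct]
      simp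
    rw [one_mul, ← sq_le_sq₀ (norm_nonneg _) (norm_nonneg _), norm_sq, norm_sq,
      Matrix.ofLp_toEuclideanCLM]
    exact h _

lemma exists_transpose_mul_self {P : Matrix (Fin m) (Fin m) ℝ} (hP : P.PosSemidef) :
    ∃ B : Matrix (Fin m) (Fin m) ℝ, P = Bᵀ * B := by
  open scoped MatrixOrder Matrix.Norms.L2Operator in
  obtain ⟨B, hB⟩ := CStarAlgebra.nonneg_iff_eq_star_mul_self.mp hP.nonneg
  exact ⟨B, by rw [hB, star_eq_conjTranspose, conjTranspose_eq_transpose_of_trivial]⟩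

/-- Tangent directions `t • (z - x)` at an orthogonal matrix `x`, translated to the identity by
`xᵀ`, have negative semidefinite symmetric part. -/
lemma posSemidef_symm_part {x z : Matrix (Fin m) (Fin m) ℝ} (hx : xᵀ * x = 1)
    (hz : specNorm z ≤ 1) {t : ℝ} (ht : 0 ≤ t) :
    (-(xᵀ * (t • (z - x)) + (xᵀ * (t • (z - x)))ᵀ)).PosSemidef := by
  refine PosSemidef.of_dotProduct_mulVec_nonneg ?_ fun v => ?_
  · rw [IsHermitian, conjTranspose_eq_transpose_of_trivial]
    simp [add_comm]
  · have hxv : (x *ᵥ v) ⬝ᵥ (x *ᵥ v) = v ⬝ᵥ v := by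
      rw [dotProduct_mulVec, vecMul_mulVec, hx, vecMul_one]
    have hzv := specNorm_le_one_iff.mp hz v
    have hn : 0 ≤ (x *ᵥ v - z *ᵥ v) ⬝ᵥ (x *ᵥ v - z *ᵥ v) := by
      simpa using dotProduct_star_self_nonneg (x *ᵥ v - z *ᵥ v)
    have key : v ⬝ᵥ ((xᵀ * (t • (z - x))) *ᵥ v) =
        t * ((x *ᵥ v) ⬝ᵥ (z *ᵥ v) - (x *ᵥ v) ⬝ᵥ (x *ᵥ v)) := by
      rw [← mulVec_mulVec, dotProduct_mulVec, vecMul_transpose, smul_mulVec, sub_mulVec,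
        dotProduct_smul, dotProduct_sub, smul_eq_mul]
    have key' : v ⬝ᵥ ((xᵀ * (t • (z - x)))ᵀ *ᵥ v) = v ⬝ᵥ ((xᵀ * (t • (z - x))) *ᵥ v) := by
      rw [mulVec_transpose, dotProduct_comm, ← dotProduct_mulVec]
    rw [star_trivial, neg_mulVec, add_mulVec, dotProduct_neg, dotProduct_add, key', key]
    simp only [dotProduct_sub, sub_dotProduct, dotProduct_comm (z *ᵥ v) (x *ᵥ v)] at hn
    nlinarith

lemma symmetric_tangent_cone_eq :
    {d | ∃ t : ℝ, 0 ≤ t ∧ ∃ M : Matrix (Fin m) (Fin m) ℝ,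
        M.IsSymm ∧ specNorm M ≤ 1 ∧ d = t • (M - 1)} =
      {N : Matrix (Fin m) (Fin m) ℝ | (-N).PosSemidef} := by
  ext N
  simp only [Set.mem_ofPred_eq]
  constructor
  · rintro ⟨t, ht, M, hM, hn, rfl⟩
    have h := posSemidef_symm_part (x := 1) (by simp) hn (div_nonneg ht zero_le_two)
    convert h using 1
    simp only [transpose_one, one_mul, transpose_smul, transpose_sub, hM.eq]
    module
  · intro h
    obtain ⟨B, hB⟩ := exists_transpose_mul_self h
    set c := specNorm Bᵀ ^ 2 + 1 with hc
    have hc0 : 0 < c := by positivity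
    refine ⟨c, hc0.le, 1 + c⁻¹ • N, ?_, specNorm_le_one_iff.mpr fun v => ?_, ?_⟩
    · have : N.IsSymm := by
        have := congrArg transpose hB
        rw [transpose_mul, transpose_transpose, ← hB, transpose_neg, neg_inj] at this
        exact this
      exact isSymm_one.add (this.smul _)
    · have hN : N *ᵥ v = -(Bᵀ *ᵥ (B *ᵥ v)) := by
        rw [mulVec_mulVec, ← hB, neg_mulVec, neg_neg]
      have h1 := dotProduct_mulVec_le_specNorm_sq Bᵀ (B *ᵥ v)
      have h2 : v ⬝ᵥ (Bᵀ *ᵥ (B *ᵥ v)) = (B *ᵥ v) ⬝ᵥ (B *ᵥ v) := by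
        rw [dotProduct_mulVec, vecMul_transpose]
      have h3 : 0 ≤ (B *ᵥ v) ⬝ᵥ (B *ᵥ v) := by simpa using dotProduct_star_self_nonneg (B *ᵥ v)
      simp only [add_mulVec, one_mulVec, smul_mulVec, hN, dotProduct_add, add_dotProduct,
        dotProduct_smul, smul_dotProduct, dotProduct_neg, neg_dotProduct, smul_eq_mul, h2,
        dotProduct_comm (Bᵀ *ᵥ (B *ᵥ v)) v]
      set p := (Bᵀ *ᵥ (B *ᵥ v)) ⬝ᵥ (Bᵀ *ᵥ (B *ᵥ v))
      set r := (B *ᵥ v) ⬝ᵥ (B *ᵥ v)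
      have h4 : c⁻¹ * p ≤ r := by
        rw [inv_mul_le_iff₀ hc0]
        nlinarith
      have h5 : 0 ≤ c⁻¹ * (r - c⁻¹ * p) := mul_nonneg (inv_nonneg.mpr hc0.le) (sub_nonneg.mpr h4)
      have h6 : 0 ≤ c⁻¹ * r := by positivity
      linarith
    · rw [add_sub_cancel_left, smul_inv_smul₀ hc0.ne']

end SpectralNorm

section TraceInequalities

variable {m : ℕ}

lemma trace_mul_nonneg_of_posSemidef {P Q : Matrix (Fin m) (Fin m) ℝ} (hP : P.PosSemidef)
    (hQ : Q.PosSemidef) : 0 ≤ (P * Q).trace := by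
  obtain ⟨B, rfl⟩ := exists_transpose_mul_self hP
  rw [Matrix.mul_assoc, trace_mul_comm]
  have := (hQ.mul_mul_conjTranspose_same B).trace_nonneg
  rwa [conjTranspose_eq_transpose_of_trivial] at this

lemma trace_transpose_mul_self_nonneg (A : Matrix (Fin m) (Fin m) ℝ) : 0 ≤ (Aᵀ * A).trace := by
  have := (posSemidef_conjTranspose_mul_self A).trace_nonneg
  rwa [conjTranspose_eq_transpose_of_trivial] at this

lemma trace_transpose_mul_comm (A B : Matrix (Fin m) (Fin m) ℝ) :
    (Aᵀ * B).trace = (Bᵀ * A).trace := by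
  rw [← trace_transpose, transpose_mul, transpose_transpose]

lemma trace_transpose_mul_transpose (A B : Matrix (Fin m) (Fin m) ℝ) :
    (Aᵀ * Bᵀ).trace = (A * B).trace := by
  rw [← transpose_mul, trace_transpose, trace_mul_comm]

/-- Two unit vectors of the cone `Skew ⊕ -PSD` are close in a norm adapted to the splitting. -/
lemma trace_sub_le_of_posSemidef {D₁ D₂ : Matrix (Fin m) (Fin m) ℝ}
    (h₁ : (-(D₁ + D₁ᵀ)).PosSemidef) (h₂ : (-(D₂ + D₂ᵀ)).PosSemidef)
    (n₁ : (D₁ᵀ * D₁).trace = 1) (n₂ : (D₂ᵀ * D₂).trace = 1) :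
    3 * ((D₁ - D₂)ᵀ * (D₁ - D₂)).trace + ((D₁ - D₂) * (D₁ - D₂)).trace ≤ 8 := by
  have hp := trace_mul_nonneg_of_posSemidef h₁ h₂
  have hs := trace_transpose_mul_self_nonneg ((D₁ + D₂) - (D₁ + D₂)ᵀ)
  simp only [transpose_add, transpose_sub, transpose_transpose, mul_add, add_mul, mul_sub, sub_mul,
    neg_mul, mul_neg, trace_add, trace_sub, trace_neg, trace_transpose_mul_transpose,
    trace_mul_comm D₁ D₁ᵀ, trace_mul_comm D₁ D₂ᵀ, trace_mul_comm D₂ D₁ᵀ, trace_mul_comm D₂ D₂ᵀ,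
    trace_transpose_mul_comm D₂ D₁,
    trace_mul_comm D₂ D₁, n₁, n₂] at hp hs ⊢
  linarith

lemma sq_trace_mul_le {H E : Matrix (Fin m) (Fin m) ℝ}
    (hE : 3 * (Eᵀ * E).trace + (E * E).trace ≤ 8) :
    (Hᵀ * E).trace ^ 2 ≤ 3 * (Hᵀ * H).trace - (H * H).trace := by
  set c := (Hᵀ * E).trace / 2 with hc
  have ha := trace_transpose_mul_self_nonneg ((2 : ℝ) • (H - Hᵀ) - c • (E - Eᵀ))
  have hs := trace_transpose_mul_self_nonneg ((H + Hᵀ) - c • (E + Eᵀ))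
  have he : (Hᵀ * E).trace = 2 * c := by rw [hc]; ring
  simp only [transpose_add, transpose_sub, transpose_smul, transpose_transpose, mul_add, add_mul,
    mul_sub, sub_mul, smul_mul_assoc, mul_smul_comm, trace_add, trace_sub, trace_smul, smul_add,
    smul_sub, smul_eq_mul, trace_transpose_mul_transpose,
    trace_mul_comm H Hᵀ, trace_mul_comm H Eᵀ, trace_mul_comm E Hᵀ, trace_mul_comm E Eᵀ,
    trace_transpose_mul_comm E H,
    trace_mul_comm E H, he] at ha hs ⊢
  nlinarith [mul_le_mul_of_nonneg_left hE (sq_nonneg c)]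

end TraceInequalities

section Gaussian

variable {m : ℕ}

instance : IsProbabilityMeasure (matStdGaussian m) := by
  unfold matStdGaussian
  infer_instance

instance : (gaussianReal 0 1).IsNegInvariant :=
  ⟨by simpa using! gaussianReal_map_neg (μ := 0) (v := 1)⟩

instance : (matStdGaussian m).IsNegInvariant :=
  have : (Measure.pi fun _ : Fin m => gaussianReal 0 1).IsNegInvariant :=
    Measure.pi.isNegInvariant _
  Measure.pi.isNegInvariant _

lemma measurePreserving_entry (i j : Fin m) :
    MeasurePreserving (fun G : Fin m → Fin m → ℝ => G i j) (matStdGaussian m)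
      (gaussianReal 0 1) :=
  (measurePreserving_eval (fun _ : Fin m => gaussianReal 0 1) j).comp
    (measurePreserving_eval
      (fun _ : Fin m => Measure.pi fun _ : Fin m => gaussianReal 0 1) i)

lemma memLp_entry (i j : Fin m) :
    MemLp (fun G : Fin m → Fin m → ℝ => G i j) 2 (matStdGaussian m) :=
  (memLp_id_gaussianReal 2).comp_measurePreserving (measurePreserving_entry i j)

lemma integrable_entry_mul_entry (i j k l : Fin m) :
    Integrable (fun G : Fin m → Fin m → ℝ => G i j * G k l) (matStdGaussian m) :=
  (memLp_entry i j).integrable_mul (memLp_entry k l)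

lemma integral_entry (i j : Fin m) : ∫ G, G i j ∂(matStdGaussian m) = 0 := by
  have h := (measurePreserving_entry i j).map_eq
  rw [← integral_id_gaussianReal (μ := 0) (v := 1), ← h,
    integral_map (measurePreserving_entry i j).aemeasurable (by fun_prop)]

lemma integral_entry_mul_self (i j : Fin m) :
    ∫ G, G i j * G i j ∂(matStdGaussian m) = 1 := by
  have h : ∫ y, y * y ∂(gaussianReal 0 1) = 1 := by
    have := variance_fun_id_gaussianReal (μ := 0) (v := 1)
    rw [variance_of_integral_eq_zero (by fun_prop) (by simp)] at this
    simpa [sq] using this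
  rw [← (measurePreserving_entry i j).map_eq,
    integral_map (measurePreserving_entry i j).aemeasurable (by fun_prop)] at h
  exact h

lemma indepFun_entry {i j k l : Fin m} (h : ¬(i = k ∧ j = l)) :
    IndepFun (fun G : Fin m → Fin m → ℝ => G i j) (fun G => G k l) (matStdGaussian m) := by
  let ν : Fin m → Measure (Fin m → ℝ) := fun _ => Measure.pi fun _ : Fin m => gaussianReal 0 1
  by_cases hik : i = k
  · subst hik
    have hrow : IndepFun (fun g : Fin m → ℝ => g j) (fun g => g l) (ν i) :=
      (iIndepFun_pi (X := fun _ y => y) fun _ => aemeasurable_id).indepFun fun hjl => h ⟨rfl, hjl⟩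
    have hj := measurable_pi_apply (X := fun _ : Fin m => ℝ) j
    have hl := measurable_pi_apply (X := fun _ : Fin m => ℝ) l
    have hi := (measurePreserving_eval ν i).measurable
    rw [← (measurePreserving_eval ν i).map_eq,
      indepFun_iff_map_prod_eq_prod_map_map hj.aemeasurable hl.aemeasurable,
      Measure.map_map (hj.prodMk hl) hi, Measure.map_map hj hi, Measure.map_map hl hi] at hrow
    rw [indepFun_iff_map_prod_eq_prod_map_map (measurePreserving_entry i j).aemeasurable
      (measurePreserving_entry i l).aemeasurable]
    exact hrow
  · exact ((iIndepFun_pi (μ := ν) (X := fun _ y => y) fun _ => aemeasurable_id).indepFun hik).comp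
      (measurable_pi_apply j) (measurable_pi_apply l)

lemma integral_entry_mul_entry (i j k l : Fin m) :
    ∫ G, G i j * G k l ∂(matStdGaussian m) = if i = k ∧ j = l then 1 else 0 := by
  split_ifs with h
  · obtain ⟨rfl, rfl⟩ := h
    exact integral_entry_mul_self i j
  · rw [(indepFun_entry h).integral_fun_mul_eq_mul_integral
      (memLp_entry i j).aestronglyMeasurable (memLp_entry k l).aestronglyMeasurable,
      integral_entry, zero_mul]

lemma integrable_and_integral_trace_transpose_mul_self :
    Integrable (fun G => ((of G)ᵀ * of G).trace) (matStdGaussian m) ∧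
    ∫ G, ((of G)ᵀ * of G).trace ∂(matStdGaussian m) = (m : ℝ) ^ 2 := by
  simp only [trace, diag_apply, Matrix.mul_apply, transpose_apply, of_apply]
  constructor
  · exact integrable_finsetSum _ fun i _ => integrable_finsetSum _ fun j _ =>
      integrable_entry_mul_entry j i j i
  · rw [integral_finsetSum _ fun i _ => integrable_finsetSum _ fun j _ =>
      integrable_entry_mul_entry j i j i]
    simp_rw [integral_finsetSum _ fun j _ => integrable_entry_mul_entry j _ j _,
      integral_entry_mul_self]
    simp [sq]

lemma integrable_and_integral_trace_mul_mul_mul (A : Matrix (Fin m) (Fin m) ℝ) :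
    Integrable (fun G => ((A * of G) * (A * of G)).trace) (matStdGaussian m) ∧
    ∫ G, ((A * of G) * (A * of G)).trace ∂(matStdGaussian m) = (Aᵀ * A).trace := by
  have expand (G : Fin m → Fin m → ℝ) : ((A * of G) * (A * of G)).trace =
      ∑ i, ∑ j, ∑ k, ∑ l, A i k * A j l * (G k j * G l i) := by
    simp only [trace, diag_apply, Matrix.mul_apply, Finset.sum_mul_sum, of_apply]
    refine Finset.sum_congr rfl fun i _ => Finset.sum_congr rfl fun j _ =>
      Finset.sum_congr rfl fun k _ => Finset.sum_congr rfl fun l _ => by ring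
  have hint (i j k l : Fin m) :
      Integrable (fun G : Fin m → Fin m → ℝ => A i k * A j l * (G k j * G l i))
        (matStdGaussian m) := (integrable_entry_mul_entry k j l i).const_mul _
  have hint₁ (i j k : Fin m) := integrable_finsetSum Finset.univ fun l _ => hint i j k l
  have hint₂ (i j : Fin m) := integrable_finsetSum Finset.univ fun k _ => hint₁ i j k
  have hint₃ (i : Fin m) := integrable_finsetSum Finset.univ fun j _ => hint₂ i j
  simp only [expand]
  refine ⟨integrable_finsetSum Finset.univ fun i _ => hint₃ i, ?_⟩
  rw [integral_finsetSum _ fun i _ => hint₃ i]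
  simp_rw [integral_finsetSum _ fun j _ => hint₂ _ j, integral_finsetSum _ fun k _ => hint₁ _ _ k,
    integral_finsetSum _ fun l _ => hint _ _ _ l, integral_const_mul, integral_entry_mul_entry]
  simp only [trace, diag_apply, Matrix.mul_apply, transpose_apply]
  simpa [ite_and] using Finset.sum_comm

/-- If the oscillation of `⟨G, ·⟩` over `S` is controlled by an integrable function of `G`,
then so is the Gaussian width of `S`. -/
lemma matGaussianWidth_sq_le {S : Set (Matrix (Fin m) (Fin m) ℝ)}
    {Q : (Fin m → Fin m → ℝ) → ℝ} (hQ : Integrable Q (matStdGaussian m)) (hQ0 : ∀ G, 0 ≤ Q G)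
    (h : ∀ G, ∀ Z ∈ S, ∀ W ∈ S,
      (∑ i, ∑ j, G i j * Z i j - ∑ i, ∑ j, G i j * W i j) ^ 2 ≤ Q G) :
    4 * matGaussianWidth S ^ 2 ≤ ∫ G, Q G ∂(matStdGaussian m) := by
  have hQint : 0 ≤ ∫ G, Q G ∂(matStdGaussian m) := integral_nonneg hQ0
  unfold matGaussianWidth
  set f : (Fin m → Fin m → ℝ) → ℝ := fun G =>
    sSup ((fun Z : Matrix (Fin m) (Fin m) ℝ => ∑ i, ∑ j, G i j * Z i j) '' S) with hf
  rcases S.eq_empty_or_nonempty with rfl | ⟨Z₀, hZ₀⟩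
  · simpa [hf] using hQint
  by_cases hfi : Integrable f (matStdGaussian m)
  swap
  · rw [integral_undef hfi]
    simpa using hQint
  have hle (G) (Z) (hZ : Z ∈ S) (W) (hW : W ∈ S) :
      ∑ i, ∑ j, G i j * Z i j ≤ √(Q G) + ∑ i, ∑ j, G i j * W i j := by
    linarith [Real.le_sqrt_of_sq_le (h G Z hZ W hW)]
  have hbdd (G : Fin m → Fin m → ℝ) :
      BddAbove ((fun Z : Matrix (Fin m) (Fin m) ℝ => ∑ i, ∑ j, G i j * Z i j) '' S) := by
    refine ⟨√(Q G) + ∑ i, ∑ j, G i j * Z₀ i j, ?_⟩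
    rintro _ ⟨Z, hZ, rfl⟩
    exact hle G Z hZ Z₀ hZ₀
  have hneg (G : Fin m → Fin m → ℝ) (Z : Matrix (Fin m) (Fin m) ℝ) :
      ∑ i, ∑ j, (-G) i j * Z i j = -∑ i, ∑ j, G i j * Z i j := by
    simp
  have hub (G) : f G + f (-G) ≤ √(Q G) := by
    have h1 (W) (hW : W ∈ S) : f G ≤ √(Q G) + ∑ i, ∑ j, G i j * W i j := by
      refine csSup_le ⟨_, Z₀, hZ₀, rfl⟩ ?_
      rintro _ ⟨Z, hZ, rfl⟩
      exact hle G Z hZ W hW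
    have h2 : f (-G) ≤ √(Q G) - f G := by
      refine csSup_le ⟨_, Z₀, hZ₀, rfl⟩ ?_
      rintro _ ⟨W, hW, rfl⟩
      have := h1 W hW
      simp only [hneg]
      linarith
    linarith
  have hlb (G) : 0 ≤ f G + f (-G) := by
    have h1 := le_csSup (hbdd G) ⟨Z₀, hZ₀, rfl⟩
    have h2 := le_csSup (hbdd (-G)) ⟨Z₀, hZ₀, rfl⟩
    simp only [hneg] at h1 h2
    simp only [hf, hneg]
    linarith
  set w := ∫ G, f G ∂(matStdGaussian m) with hw
  have hfn : Integrable (fun G => f (-G)) (matStdGaussian m) := hfi.comp_neg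
  have hsum : ∫ G, (f G + f (-G)) ∂(matStdGaussian m) = 2 * w := by
    rw [integral_add hfi hfn, integral_neg_eq_self f]
    ring
  have hmono : ∫ G, (4 * w) * (f G + f (-G)) ∂(matStdGaussian m) ≤
      ∫ G, ((2 * w) ^ 2 + Q G) ∂(matStdGaussian m) := by
    refine integral_mono ((hfi.add hfn).const_mul _) ((integrable_const _).add hQ) fun G => ?_
    have hsq : (f G + f (-G)) ^ 2 ≤ Q G := by
      simpa [Real.sq_sqrt (hQ0 G)] using pow_le_pow_left₀ (hlb G) (hub G) 2
    have := sq_nonneg (2 * w - (f G + f (-G)))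
    dsimp only
    linarith
  rw [integral_const_mul, hsum, integral_add (integrable_const _) hQ] at hmono
  simp only [integral_const, probReal_univ, one_smul] at hmono
  linarith

end Gaussian

/-- For an orthogonal matrix `x* ∈ ℝ^{m×m}` and the tangent cone `T`
at `x*` with respect to the spectral-norm unit ball, the symmetric component of the
tangent cone at the identity equals `-PSD_m`:
`cone{M - I : M symmetric, ‖M‖_op ≤ 1} = -PSD_m`, and consequently
`w(T ∩ S^{m²-1})² ≤ (3m² - m)/4`. -/
theorem orthogonal_matrix_tangent_cone_width {m : ℕ}
    (xstar : Matrix (Fin m) (Fin m) ℝ) (hx : xstarᵀ * xstar = 1)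
    (T : Set (Matrix (Fin m) (Fin m) ℝ))
    (hT : T = {d | ∃ t : ℝ, 0 ≤ t ∧ ∃ z, specNorm z ≤ 1 ∧ d = t • (z - xstar)}) :
    {d | ∃ t : ℝ, 0 ≤ t ∧ ∃ M : Matrix (Fin m) (Fin m) ℝ,
        M.IsSymm ∧ specNorm M ≤ 1 ∧ d = t • (M - 1)} =
      {N : Matrix (Fin m) (Fin m) ℝ | (-N).PosSemidef} ∧
    matGaussianWidth (T ∩ frobSphere m) ^ 2 ≤ (3 * (m : ℝ) ^ 2 - m) / 4 := by
  refine ⟨symmetric_tangent_cone_eq, ?_⟩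
  have hx' : xstar * xstarᵀ = 1 := mul_eq_one_comm.mp hx
  have htr (A B : Matrix (Fin m) (Fin m) ℝ) :
      ((xstarᵀ * A)ᵀ * (xstarᵀ * B)).trace = (Aᵀ * B).trace := by
    rw [transpose_mul, transpose_transpose, Matrix.mul_assoc, ← Matrix.mul_assoc xstar, hx',
      Matrix.one_mul]
  have hsum (A B : Matrix (Fin m) (Fin m) ℝ) : ∑ i, ∑ j, A i j * B i j = (Aᵀ * B).trace := by
    simp only [trace, diag_apply, Matrix.mul_apply, transpose_apply]
    exact Finset.sum_comm
  let Q : (Fin m → Fin m → ℝ) → ℝ := fun G =>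
    3 * ((of G)ᵀ * of G).trace - ((xstarᵀ * of G) * (xstarᵀ * of G)).trace
  have hQ0 (G) : 0 ≤ Q G := by
    have := sq_trace_mul_le (H := xstarᵀ * of G) (E := 0) (by simp)
    rw [htr] at this
    simpa [Q] using this
  obtain ⟨hi₁, he₁⟩ := integrable_and_integral_trace_transpose_mul_self (m := m)
  obtain ⟨hi₂, he₂⟩ := integrable_and_integral_trace_mul_mul_mul xstarᵀ
  have hQint : ∫ G, Q G ∂(matStdGaussian m) = 3 * (m : ℝ) ^ 2 - m := by
    unfold Q
    rw [integral_sub (hi₁.const_mul 3) hi₂, integral_const_mul, he₁, he₂, transpose_transpose, hx']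
    simp
  have hmem {Z} (hZ : Z ∈ T ∩ frobSphere m) :
      (-(xstarᵀ * Z + (xstarᵀ * Z)ᵀ)).PosSemidef ∧
        ((xstarᵀ * Z)ᵀ * (xstarᵀ * Z)).trace = 1 := by
    obtain ⟨hZT, hZs⟩ := hZ
    rw [hT] at hZT
    refine ⟨?_, ?_⟩
    · obtain ⟨t, ht, z, hz, rfl⟩ := hZT
      exact posSemidef_symm_part hx hz ht
    · rw [htr, ← hsum]
      simpa [frobSphere, sq] using hZs
  have key := matGaussianWidth_sq_le (S := T ∩ frobSphere m) (hi₁.const_mul 3 |>.sub hi₂) hQ0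
    fun G Z hZ W hW => by
      obtain ⟨hZ₁, hZ₂⟩ := hmem hZ
      obtain ⟨hW₁, hW₂⟩ := hmem hW
      have := sq_trace_mul_le (H := xstarᵀ * of G) (trace_sub_le_of_posSemidef hZ₁ hW₁ hZ₂ hW₂)
      rw [← Matrix.mul_sub, htr, htr, Matrix.mul_sub, trace_sub, ← hsum, ← hsum] at this
      exact this
  have : 4 * matGaussianWidth (T ∩ frobSphere m) ^ 2 ≤ 3 * (m : ℝ) ^ 2 - m := key.trans_eq hQint
  linarith
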